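/- For a linear system, the UKF output-error covariance is missing the process-noise term: P_z^UKF = C·A·P·Aᵀ·Cᵀ + R = (C·P_prior·Cᵀ + R) − C·Q·Cᵀ. -/

import Mathlib

open Matrix

/-- UKF weight vector `W ∈ ℝ^{2n+1}`. -/
noncomputable def ukfW (n : ℕ) (α : ℝ) : Fin (2*n+1) → ℝ :=
  fun i => if i.val = 0 then (α^2 - 1)/α^2 else 1/(2*α^2*n)

/-- Perturbation matrix `Δ(α, B)`: first column 0, next n columns `α·bᵢ`,
last n columns `−α·bᵢ`. -/
noncomputable def ukfDelta (n : ℕ) (α : ℝ) (B : Matrix (Fin n) (Fin n) ℝ) :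
    Matrix (Fin n) (Fin (2*n+1)) ℝ :=
  Matrix.of fun i j =>
    if h0 : j.val = 0 then 0
    else if h1 : j.val ≤ n then α * B i ⟨j.val - 1, by omega⟩
    else -(α * B i ⟨j.val - n - 1, by have := j.isLt; omega⟩)

/-- Sigma-point matrix `X(x̂, α, B)`: j-th column is `x̂` plus the j-th column of `Δ(α, B)`. -/
noncomputable def sigmaPts {n : ℕ} (xhat : Fin n → ℝ) (α : ℝ)
    (B : Matrix (Fin n) (Fin n) ℝ) : Matrix (Fin n) (Fin (2*n+1)) ℝ :=
  Matrix.of fun i j => xhat i + ukfDelta n α B i j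

/-- Affine propagation of an ensemble: j-th column of the result is `A·(j-th column of X) + u`. -/
noncomputable def propagate {n : ℕ} (A : Matrix (Fin n) (Fin n) ℝ) (u : Fin n → ℝ)
    (X : Matrix (Fin n) (Fin (2*n+1)) ℝ) : Matrix (Fin n) (Fin (2*n+1)) ℝ :=
  Matrix.of fun i j => A.mulVec (fun r => X r j) i + u i

/-- Deviation matrix `X̃ = X − (X·W)·1ᵀ`. -/
noncomputable def devMat {q m : ℕ} (w : Fin m → ℝ) (X : Matrix (Fin q) (Fin m) ℝ) :
    Matrix (Fin q) (Fin m) ℝ :=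
  X - Matrix.vecMulVec (X.mulVec w) (fun _ => 1)

/-- Posterior covariance as a function of the gain:
`P(K̂) = P_prior + K̂·R̄·K̂ᵀ − K̂·C·P_prior − P_prior·Cᵀ·K̂ᵀ`. -/
noncomputable def postCov {n p : ℕ} (Pprior : Matrix (Fin n) (Fin n) ℝ)
    (C : Matrix (Fin p) (Fin n) ℝ) (Rbar : Matrix (Fin p) (Fin p) ℝ)
    (K : Matrix (Fin n) (Fin p) ℝ) : Matrix (Fin n) (Fin n) ℝ :=
  Pprior + K * Rbar * Kᵀ - K * C * Pprior - Pprior * Cᵀ * Kᵀ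

/-- A sum over `Fin (2n+1)` splits into the center term and the two blocks of `n` terms. -/
lemma sum_fin_two_mul_add_one {M : Type*} [AddCommMonoid M] (n : ℕ) (f : Fin (2*n+1) → M) :
    ∑ j, f j = f 0 + (∑ i : Fin n, f ⟨i.val + 1, by omega⟩ +
      ∑ i : Fin n, f ⟨n + i.val + 1, by omega⟩) := by
  have h : n + n = 2 * n := by omega
  rw [Fin.sum_univ_succ, ← (finCongr h).sum_comp, Fin.sum_univ_add]
  rfl

lemma ukfW_zero (n : ℕ) (α : ℝ) : ukfW n α 0 = (α^2 - 1)/α^2 := by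
  simp [ukfW]

lemma ukfW_succ {n : ℕ} (α : ℝ) (k : ℕ) (hk : k + 1 < 2*n+1) :
    ukfW n α ⟨k + 1, hk⟩ = 1/(2*α^2*n) := by
  simp [ukfW]

lemma ukfDelta_zero {n : ℕ} (α : ℝ) (B : Matrix (Fin n) (Fin n) ℝ) (r : Fin n) :
    ukfDelta n α B r 0 = 0 := by
  simp [ukfDelta]

lemma ukfDelta_pos_block {n : ℕ} (α : ℝ) (B : Matrix (Fin n) (Fin n) ℝ) (r i : Fin n) :
    ukfDelta n α B r ⟨i.val + 1, by omega⟩ = α * B r i := by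
  have h : i.val + 1 ≤ n := i.isLt
  simp [ukfDelta, h]

lemma ukfDelta_neg_block {n : ℕ} (α : ℝ) (B : Matrix (Fin n) (Fin n) ℝ) (r i : Fin n) :
    ukfDelta n α B r ⟨n + i.val + 1, by omega⟩ = -(α * B r i) := by
  have h : ¬ n + i.val + 1 ≤ n := by omega
  have h' : n + i.val + 1 - n - 1 = i.val := by omega
  simp [ukfDelta, h, h']

lemma sum_ukfW {n : ℕ} (hn : 0 < n) {α : ℝ} (hα : α ≠ 0) : ∑ j, ukfW n α j = 1 := by
  have hn' : (n : ℝ) ≠ 0 := by positivity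
  simp only [sum_fin_two_mul_add_one, ukfW_zero, ukfW_succ, Finset.sum_const, Finset.card_univ,
    Fintype.card_fin, nsmul_eq_mul]
  field_simp
  ring

lemma ukfDelta_mulVec_ukfW (n : ℕ) (α : ℝ) (B : Matrix (Fin n) (Fin n) ℝ) :
    ukfDelta n α B *ᵥ ukfW n α = 0 := by
  ext r
  simp [mulVec, dotProduct, sum_fin_two_mul_add_one, ukfDelta_zero, ukfDelta_pos_block,
    ukfDelta_neg_block, ukfW_succ]

/-- The weighted second moment of the perturbations is `n⁻¹ • B Bᵀ`. -/
lemma ukfDelta_mul_diagonal_mul_transpose {n : ℕ} (hn : 0 < n) {α : ℝ} (hα : α ≠ 0)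
    (B : Matrix (Fin n) (Fin n) ℝ) :
    ukfDelta n α B * diagonal (ukfW n α) * (ukfDelta n α B)ᵀ = (n : ℝ)⁻¹ • (B * Bᵀ) := by
  have hn' : (n : ℝ) ≠ 0 := by positivity
  ext r s
  rw [Matrix.smul_apply, mul_apply, mul_apply]
  simp only [mul_diagonal, transpose_apply, sum_fin_two_mul_add_one, ukfDelta_zero,
    ukfDelta_pos_block, ukfDelta_neg_block, ukfW_succ, smul_eq_mul,
    Finset.mul_sum, zero_mul, zero_add, ← Finset.sum_add_distrib]
  refine Finset.sum_congr rfl fun i _ => ?_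
  field_simp
  ring

lemma propagate_sigmaPts {n : ℕ} (A : Matrix (Fin n) (Fin n) ℝ) (u xhat : Fin n → ℝ) (α : ℝ)
    (B : Matrix (Fin n) (Fin n) ℝ) :
    propagate A u (sigmaPts xhat α B) =
      A * ukfDelta n α B + vecMulVec (A *ᵥ xhat + u) (fun _ => 1) := by
  ext i j
  simp only [propagate, sigmaPts, of_apply, mulVec, dotProduct, Matrix.add_apply, mul_apply,
    vecMulVec_apply, Pi.add_apply, mul_add, Finset.sum_add_distrib]
  ring

/-- Removing the weighted mean undoes a common translation of a weighted-mean-zero ensemble. -/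
lemma devMat_add_vecMulVec_one {q m : ℕ} {w : Fin m → ℝ} (hw : ∑ j, w j = 1)
    {M : Matrix (Fin q) (Fin m) ℝ} (hM : M *ᵥ w = 0) (c : Fin q → ℝ) :
    devMat w (M + vecMulVec c (fun _ => 1)) = M := by
  have hc : vecMulVec c (fun _ => 1) *ᵥ w = c := by
    ext i
    simp [mulVec, dotProduct, vecMulVec_apply, ← Finset.mul_sum, hw]
  rw [devMat, add_mulVec, hM, hc, zero_add, add_sub_cancel_right]

theorem stmt9 {n p : ℕ} (hn : 0 < n) (hp : 0 < p)
    (A : Matrix (Fin n) (Fin n) ℝ) (C : Matrix (Fin p) (Fin n) ℝ)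
    (Q P : Matrix (Fin n) (Fin n) ℝ) (R : Matrix (Fin p) (Fin p) ℝ)
    (hQ : Q.PosSemidef) (hR : R.PosDef) (hP : P.PosSemidef)
    (xhat u : Fin n → ℝ) (α : ℝ) (hα : α ≠ 0)
    (B : Matrix (Fin n) (Fin n) ℝ) (hB : B * Bᵀ = (n : ℝ) • P)
    (X' : Matrix (Fin n) (Fin (2*n+1)) ℝ) (hX' : X' = propagate A u (sigmaPts xhat α B))
    (Xt : Matrix (Fin n) (Fin (2*n+1)) ℝ) (hXt : Xt = devMat (ukfW n α) X')
    (Yt : Matrix (Fin p) (Fin (2*n+1)) ℝ) (hYt : Yt = devMat (ukfW n α) (C * X')) :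
    Yt * Matrix.diagonal (ukfW n α) * Ytᵀ + R = C * A * P * Aᵀ * Cᵀ + R ∧
    Yt * Matrix.diagonal (ukfW n α) * Ytᵀ + R =
      (C * (A * P * Aᵀ + Q) * Cᵀ + R) - C * Q * Cᵀ := by
  have hn' : (n : ℝ) ≠ 0 := by positivity
  have hY : Yt = C * A * ukfDelta n α B := by
    rw [hYt, hX', propagate_sigmaPts, Matrix.mul_add, mul_vecMulVec, ← Matrix.mul_assoc]
    refine devMat_add_vecMulVec_one (sum_ukfW hn hα) ?_ _
    rw [← mulVec_mulVec, ukfDelta_mulVec_ukfW, mulVec_zero]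
  have hcov : Yt * diagonal (ukfW n α) * Ytᵀ = C * A * P * Aᵀ * Cᵀ := by
    have hP' : ukfDelta n α B * (diagonal (ukfW n α) * (ukfDelta n α B)ᵀ) = P := by
      rw [← Matrix.mul_assoc, ukfDelta_mul_diagonal_mul_transpose hn hα, hB, smul_smul,
        inv_mul_cancel₀ hn', one_smul]
    calc Yt * diagonal (ukfW n α) * Ytᵀ
        = C * A * (ukfDelta n α B * (diagonal (ukfW n α) * (ukfDelta n α B)ᵀ)) * Aᵀ * Cᵀ := by
          simp only [hY, transpose_mul, Matrix.mul_assoc]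
      _ = C * A * P * Aᵀ * Cᵀ := by rw [hP']
  refine ⟨by rw [hcov], ?_⟩
  rw [hcov]
  simp only [Matrix.mul_add, Matrix.add_mul, Matrix.mul_assoc]
  abel
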